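/- One-shot converse inequality (core of the proof of Theorem 2): let Y, X_A, X_U be random variables on finite alphabets with a joint pmf, let 𝒮 and ℳ be nonempty finite sets, and let S = σ(Y) ∈ 𝒮, M = φ(Y) ∈ ℳ, and Ŝ = ψ(X_A, M) ∈ 𝒮 for functions σ, φ, ψ. Then H(S | M, X_U) ≤ I(Y; X_A | X_U) + 1 + P[Ŝ ≠ S]·log₂|𝒮|, and consequently log₂|𝒮| ≤ I(Y; X_A | X_U) + ( log₂|𝒮| − H(S) ) + I(S; M, X_U) + 1 + P[Ŝ ≠ S]·log₂|𝒮|, where all entropies and mutual informations are Shannon quantities in base 2. -/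

import Mathlib

open scoped BigOperators
open Finset Filter

noncomputable section

namespace SecretSharing

open scoped Classical

/-! ### Basic Shannon information quantities (base 2) on finite probability spaces -/

variable {Ω : Type*} [Fintype Ω]

/-- `p` is a probability mass function on the finite type `Ω`. -/
def IsPMF (p : Ω → ℝ) : Prop := (∀ ω, 0 ≤ p ω) ∧ ∑ ω : Ω, p ω = 1

/-- Probability that the random variable `X` takes the value `a` under `p`. -/
def prob (p : Ω → ℝ) {A : Type*} (X : Ω → A) (a : A) : ℝ :=
  ∑ ω : Ω, if X ω = a then p ω else 0

/-- Shannon entropy (in bits) of the random variable `X` under `p`. -/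
def ent (p : Ω → ℝ) {A : Type*} [Fintype A] (X : Ω → A) : ℝ :=
  -∑ a : A, prob p X a * Real.logb 2 (prob p X a)

/-- Conditional Shannon entropy `H(X | Y)` in bits. -/
def condEnt (p : Ω → ℝ) {A B : Type*} [Fintype A] [Fintype B]
    (X : Ω → A) (Y : Ω → B) : ℝ :=
  ent p (fun ω => (X ω, Y ω)) - ent p Y

/-- Mutual information `I(X ; Y)` in bits. -/
def mutInf (p : Ω → ℝ) {A B : Type*} [Fintype A] [Fintype B]
    (X : Ω → A) (Y : Ω → B) : ℝ :=
  ent p X + ent p Y - ent p (fun ω => (X ω, Y ω))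

/-- Conditional mutual information `I(X ; Y | Z)` in bits. -/
def condMutInf (p : Ω → ℝ) {A B C : Type*} [Fintype A] [Fintype B] [Fintype C]
    (X : Ω → A) (Y : Ω → B) (Z : Ω → C) : ℝ :=
  condEnt p X Z - condEnt p X (fun ω => (Y ω, Z ω))


/-- Conditional min-entropy `H∞(w | q) = −log₂ max_{a, z ∈ supp(q)} w(a,z)/q(z)`
of a (sub-normalized nonnegative) joint function `w` given a pmf `q`. -/
def condMinEnt {A Z : Type*} (w : A → Z → ℝ) (q : Z → ℝ) : ℝ :=
  - Real.logb 2 (sSup {y : ℝ | ∃ a z, q z ≠ 0 ∧ y = w a z / q z})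

/-- Min-entropy `H∞(w) = −log₂ max w`. -/
def minEnt {A : Type*} (w : A → ℝ) : ℝ :=
  - Real.logb 2 (sSup (Set.range w))

/-- A family `F` of hash functions (given by the evaluation map `ev`) from `A`
to `{0,1}^r` is two-universal: for `x ≠ x'`, a uniformly chosen member collides
on `x, x'` with probability at most `2^{-r}`. -/
def TwoUniversal {A : Type*} (F : Type*) [Fintype F] {r : ℕ}
    (ev : F → A → (Fin r → Bool)) : Prop :=
  ∀ x x' : A, x ≠ x' →
    ((Finset.univ.filter (fun f : F => ev f x = ev f x')).card : ℝ)
        / (Fintype.card F : ℝ)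
      ≤ ((2 : ℝ) ^ r)⁻¹

/-! ### Helper lemmas -/

lemma prob_nonneg' {p : Ω → ℝ} (hp : IsPMF p) {A : Type*} (X : Ω → A) (a : A) :
    0 ≤ prob p X a :=
  Finset.sum_nonneg fun ω _ => by split_ifs <;> [exact hp.1 ω; exact le_rfl]

lemma prob_pos' {p : Ω → ℝ} (hp : IsPMF p) {A : Type*} (X : Ω → A) (ω : Ω) (h : 0 < p ω) :
    0 < prob p X (X ω) := by
  refine lt_of_lt_of_le h ?_
  have := Finset.single_le_sum (f := fun ω' => if X ω' = X ω then p ω' else 0)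
    (fun ω' _ => by
      show (0 : ℝ) ≤ if X ω' = X ω then p ω' else 0
      split_ifs <;> [exact hp.1 ω'; exact le_rfl]) (Finset.mem_univ ω)
  simpa [prob] using this

lemma sum_prob_mul (p : Ω → ℝ) {A : Type*} [Fintype A] (X : Ω → A) (f : A → ℝ) :
    ∑ a, prob p X a * f a = ∑ ω, p ω * f (X ω) := by
  simp only [prob, Finset.sum_mul]
  rw [Finset.sum_comm]
  refine Finset.sum_congr rfl fun ω _ => ?_
  simp [ite_mul]

lemma sum_prob_one {p : Ω → ℝ} (hp : IsPMF p) {A : Type*} [Fintype A] (X : Ω → A) :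
    ∑ a, prob p X a = 1 := by
  have := sum_prob_mul p X (fun _ => 1)
  simpa [hp.2] using this

lemma ent_eq (p : Ω → ℝ) {A : Type*} [Fintype A] (X : Ω → A) :
    ent p X = -∑ ω, p ω * Real.logb 2 (prob p X (X ω)) := by
  rw [ent, sum_prob_mul p X (fun a => Real.logb 2 (prob p X a))]

lemma ent_congr (p : Ω → ℝ) {A B : Type*} [Fintype A] [Fintype B] (X : Ω → A) (Y : Ω → B)
    (h : ∀ ω ω', X ω = X ω' ↔ Y ω = Y ω') : ent p X = ent p Y := by
  rw [ent_eq, ent_eq]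
  have : ∀ ω, prob p X (X ω) = prob p Y (Y ω) := fun ω => by simp only [prob, h]
  simp only [this]

lemma marg (p : Ω → ℝ) {A B : Type*} [Fintype A] (X : Ω → A) (Y : Ω → B) (b : B) :
    ∑ a, prob p (fun ω => (X ω, Y ω)) (a, b) = prob p Y b := by
  simp only [prob]
  rw [Finset.sum_comm]
  refine Finset.sum_congr rfl fun ω _ => ?_
  by_cases h : Y ω = b <;> simp [h]

lemma gibbs {p : Ω → ℝ} (hp : IsPMF p) {A : Type*} [Fintype A] (X : Ω → A) (f : A → ℝ)
    (hf : ∀ a, 0 ≤ f a) (hs : ∑ a, f a ≤ 1) (hpos : ∀ ω, 0 < p ω → 0 < f (X ω)) :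
    ent p X ≤ -∑ ω, p ω * Real.logb 2 (f (X ω)) := by
  rw [ent_eq, neg_le_neg_iff, ← sub_nonpos, ← Finset.sum_sub_distrib]
  have hl : 0 < Real.log 2 := Real.log_pos (by norm_num)
  have h1 : ∀ ω, p ω * Real.logb 2 (f (X ω)) - p ω * Real.logb 2 (prob p X (X ω))
      ≤ (p ω * (f (X ω) / prob p X (X ω)) - p ω) / Real.log 2 := by
    intro ω
    rcases (hp.1 ω).eq_or_lt with h | h
    · simp [← h]
    · have hP := prob_pos' hp X ω h
      have hF := hpos ω h
      have := Real.log_le_sub_one_of_pos (div_pos hF hP)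
      rw [Real.log_div hF.ne' hP.ne'] at this
      rw [Real.logb, Real.logb, ← mul_sub, ← sub_div, le_div_iff₀ hl, mul_assoc,
        div_mul_cancel₀ _ hl.ne']
      nlinarith
  refine (Finset.sum_le_sum fun ω _ => h1 ω).trans ?_
  rw [← Finset.sum_div, Finset.sum_sub_distrib, hp.2,
    ← sum_prob_mul p X (fun a => f a / prob p X a)]
  refine div_nonpos_of_nonpos_of_nonneg ?_ hl.le
  have : ∑ a, prob p X a * (f a / prob p X a) ≤ ∑ a, f a := by
    refine Finset.sum_le_sum fun a _ => ?_
    by_cases h : prob p X a = 0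
    · simp [h, hf a]
    · rw [mul_div_cancel₀ _ h]
  linarith

lemma submod {p : Ω → ℝ} (hp : IsPMF p) {A B C : Type*} [Fintype A] [Fintype B] [Fintype C]
    (X : Ω → A) (Y : Ω → B) (Z : Ω → C) :
    ent p (fun ω => (X ω, Y ω, Z ω)) + ent p Z
      ≤ ent p (fun ω => (X ω, Z ω)) + ent p (fun ω => (Y ω, Z ω)) := by
  have h := gibbs hp (fun ω => (X ω, Y ω, Z ω))
    (fun t => prob p (fun ω => (X ω, Z ω)) (t.1, t.2.2) *
      prob p (fun ω => (Y ω, Z ω)) t.2 / prob p Z t.2.2)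
    (fun t => div_nonneg (mul_nonneg (prob_nonneg' hp _ _) (prob_nonneg' hp _ _))
      (prob_nonneg' hp _ _)) ?_ ?_
  · have e : ∀ ω, p ω * Real.logb 2 (prob p (fun ω => (X ω, Z ω)) (X ω, Z ω) *
        prob p (fun ω => (Y ω, Z ω)) (Y ω, Z ω) / prob p Z (Z ω)) =
        p ω * Real.logb 2 (prob p (fun ω => (X ω, Z ω)) (X ω, Z ω)) +
        p ω * Real.logb 2 (prob p (fun ω => (Y ω, Z ω)) (Y ω, Z ω)) -
        p ω * Real.logb 2 (prob p Z (Z ω)) := by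
      intro ω
      rcases (hp.1 ω).eq_or_lt with h | h
      · simp [← h]
      · have h1 := (prob_pos' hp (fun ω => (X ω, Z ω)) ω h).ne'
        have h2 := (prob_pos' hp (fun ω => (Y ω, Z ω)) ω h).ne'
        have h3 := (prob_pos' hp Z ω h).ne'
        rw [Real.logb_div (mul_ne_zero h1 h2) h3, Real.logb_mul h1 h2]
        ring
    simp only [e, Finset.sum_sub_distrib, Finset.sum_add_distrib] at h
    rw [ent_eq p Z, ent_eq p (fun ω => (X ω, Z ω)), ent_eq p (fun ω => (Y ω, Z ω))]
    linarith
  · rw [Fintype.sum_prod_type_right, Fintype.sum_prod_type_right]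
    simp only [← Finset.sum_div, ← Finset.sum_mul, ← Finset.mul_sum, marg]
    rw [← sum_prob_one hp Z]
    refine Finset.sum_le_sum fun z _ => ?_
    by_cases h : prob p Z z = 0
    · simp [h]
    · rw [mul_div_cancel_right₀ _ h]
  · intro ω h
    exact div_pos (mul_pos (prob_pos' hp (fun ω => (X ω, Z ω)) ω h)
      (prob_pos' hp (fun ω => (Y ω, Z ω)) ω h)) (prob_pos' hp Z ω h)

lemma fano {p : Ω → ℝ} (hp : IsPMF p) {A B : Type*} [Fintype A] [Nonempty A] [Fintype B]
    (S : Ω → A) (W : Ω → B) (g : B → A) :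
    ent p (fun ω => (S ω, W ω)) ≤ ent p W + 1 +
      (∑ ω, if g (W ω) ≠ S ω then p ω else 0) * Real.logb 2 (Fintype.card A : ℝ) := by
  have hc : (0 : ℝ) < Fintype.card A := by exact_mod_cast Fintype.card_pos
  have hq : ∀ s w, 0 < (if g w = s then (1 / 2 : ℝ) else 1 / (2 * Fintype.card A)) := by
    intro s w
    split_ifs <;> positivity
  have h := gibbs hp (fun ω => (S ω, W ω))
    (fun t => (if g t.2 = t.1 then (1 / 2 : ℝ) else 1 / (2 * Fintype.card A)) * prob p W t.2)
    (fun t => mul_nonneg (hq _ _).le (prob_nonneg' hp _ _)) ?_ ?_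
  · refine h.trans (le_of_eq ?_)
    have e : ∀ ω, p ω * Real.logb 2 ((if g (W ω) = S ω then (1 / 2 : ℝ)
        else 1 / (2 * Fintype.card A)) * prob p W (W ω)) =
        p ω * Real.logb 2 (prob p W (W ω)) - p ω -
        (if g (W ω) ≠ S ω then p ω else 0) * Real.logb 2 (Fintype.card A : ℝ) := by
      intro ω
      rcases (hp.1 ω).eq_or_lt with h | h
      · simp [← h]
      · have h3 := (prob_pos' hp W ω h).ne'
        have l2 : Real.logb 2 2 = 1 := Real.logb_self_eq_one (by norm_num)
        rw [Real.logb_mul (hq _ _).ne' h3]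
        by_cases hg : g (W ω) = S ω
        · simp only [hg, if_true, ne_eq, not_true, if_false, one_div, Real.logb_inv, l2]
          ring
        · simp only [hg, if_false, ne_eq, not_false_iff, if_true, one_div, Real.logb_inv]
          rw [Real.logb_mul two_ne_zero hc.ne', l2]
          ring
    simp only [e, Finset.sum_sub_distrib, hp.2, ← Finset.sum_mul]
    rw [ent_eq p W]
    ring
  · rw [Fintype.sum_prod_type_right]
    refine le_trans ?_ (sum_prob_one hp W).le
    refine Finset.sum_le_sum fun w _ => ?_
    simp only [← Finset.sum_mul]
    refine mul_le_of_le_one_left (prob_nonneg' hp _ _) ?_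
    calc ∑ s, (if g w = s then (1 / 2 : ℝ) else 1 / (2 * Fintype.card A))
        ≤ ∑ s, ((if g w = s then (1 / 2 : ℝ) else 0) + 1 / (2 * Fintype.card A)) := by
          refine Finset.sum_le_sum fun s _ => ?_
          have : (0 : ℝ) ≤ 1 / (2 * Fintype.card A) := by positivity
          split_ifs <;> linarith
      _ = 1 := by
          rw [Finset.sum_add_distrib]
          simp only [Finset.sum_ite_eq, Finset.mem_univ, if_true, Finset.sum_const,
            Finset.card_univ, nsmul_eq_mul]
          field_simp
          norm_num
  · intro ω h
    exact mul_pos (hq _ _) (prob_pos' hp W ω h)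

/-- **One-shot converse inequality (core of the proof of Theorem 2).** If
`S = σ(Y)`, `M = φ(Y)` and `Ŝ = ψ(X_A, M)`, then
`H(S | M, X_U) ≤ I(Y ; X_A | X_U) + 1 + P[Ŝ ≠ S] log₂|𝒮|`, and consequently
`log₂|𝒮| ≤ I(Y ; X_A | X_U) + (log₂|𝒮| − H(S)) + I(S ; M, X_U) + 1 + P[Ŝ ≠ S] log₂|𝒮|`. -/
theorem one_shot_converse
    {Ω A B C 𝒮 ℳ : Type}
    [Fintype Ω] [Fintype A] [Fintype B] [Fintype C] [Fintype 𝒮] [Fintype ℳ]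
    [Nonempty 𝒮] [Nonempty ℳ]
    (p : Ω → ℝ) (hp : IsPMF p)
    (Y : Ω → A) (XA : Ω → B) (XU : Ω → C)
    (σ : A → 𝒮) (φ : A → ℳ) (ψ : B × ℳ → 𝒮) :
    (condEnt p (fun ω => σ (Y ω)) (fun ω => (φ (Y ω), XU ω))
      ≤ condMutInf p Y XA XU + 1 +
        (∑ ω : Ω, if ψ (XA ω, φ (Y ω)) ≠ σ (Y ω) then p ω else 0) *
          Real.logb 2 (Fintype.card 𝒮 : ℝ)) ∧
    (Real.logb 2 (Fintype.card 𝒮 : ℝ)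
      ≤ condMutInf p Y XA XU
        + (Real.logb 2 (Fintype.card 𝒮 : ℝ) - ent p (fun ω => σ (Y ω)))
        + mutInf p (fun ω => σ (Y ω)) (fun ω => (φ (Y ω), XU ω)) + 1
        + (∑ ω : Ω, if ψ (XA ω, φ (Y ω)) ≠ σ (Y ω) then p ω else 0) *
          Real.logb 2 (Fintype.card 𝒮 : ℝ)) := by
  have main : condEnt p (fun ω => σ (Y ω)) (fun ω => (φ (Y ω), XU ω))
      ≤ condMutInf p Y XA XU + 1 +
        (∑ ω : Ω, if ψ (XA ω, φ (Y ω)) ≠ σ (Y ω) then p ω else 0) *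
          Real.logb 2 (Fintype.card 𝒮 : ℝ) := by
    have h1 := submod hp Y XA (fun ω => (σ (Y ω), φ (Y ω), XU ω))
    have h2 := submod hp (fun ω => φ (Y ω)) XA XU
    have h3 := fano hp (fun ω => σ (Y ω)) (fun ω => (φ (Y ω), XA ω, XU ω))
      (fun t => ψ (t.2.1, t.1))
    have e1 : ent p (fun ω => (Y ω, XA ω, σ (Y ω), φ (Y ω), XU ω)) =
        ent p (fun ω => (Y ω, XA ω, XU ω)) :=
      ent_congr p _ _ fun ω ω' => by simp only [Prod.mk.injEq]; grind
    have e2 : ent p (fun ω => (Y ω, σ (Y ω), φ (Y ω), XU ω)) =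
        ent p (fun ω => (Y ω, XU ω)) :=
      ent_congr p _ _ fun ω ω' => by simp only [Prod.mk.injEq]; grind
    have e3 : ent p (fun ω => (XA ω, σ (Y ω), φ (Y ω), XU ω)) =
        ent p (fun ω => (σ (Y ω), φ (Y ω), XA ω, XU ω)) :=
      ent_congr p _ _ fun ω ω' => by simp only [Prod.mk.injEq]; tauto
    simp only [condMutInf, condEnt]
    simp only [] at h3
    linarith
  refine ⟨main, ?_⟩
  simp only [mutInf]
  simp only [condEnt] at main ⊢
  linarith

end SecretSharing
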